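/- arXiv:1408.0210 — 4 statements merged into one kernel-verified Lean document; each statement's English description precedes it below -/
import Mathlib

section
/- Under the EIM setup, the interpolant admits the purely kernel-based representation (I_d K)(x, y) = Σ_{l=1}^d Σ_{m=1}^d Δ_{l,m} K(x, y_l) K(x_m, y) for all x ∈ X and y ∈ Y, where Δ = (Bᵀ)^{-1} Γ^{-1}. -/
/-- Under the EIM setup, the interpolant admits the purely kernel-based
representation `(I_d K)(x, y) = Σ_{l,m} Δ_{l,m} K(x, y_l) K(x_m, y)` with
`Δ = (Bᵀ)⁻¹ Γ⁻¹`. -/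
theorem eim_kernel_based_representation
    {X Y : Type*} [Nonempty X] [Nonempty Y]
    (d : ℕ) (hd : 1 ≤ d)
    (K : X × Y → ℝ) (x : Fin d → X) (y : Fin d → Y) (q : Fin d → Y → ℝ)
    (B : Matrix (Fin d) (Fin d) ℝ)
    (hBdef : ∀ l m : Fin d, B l m = q m (y l))
    (hBinv : IsUnit B)
    (Γ : Matrix (Fin d) (Fin d) ℝ)
    (hΓinv : IsUnit Γ)
    (hΓ : ∀ (j : Fin d) (v : Y), K (x j, v) = ∑ m, Γ j m * q m v)
    (lam : X → Fin d → ℝ)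
    (hlam : ∀ (u : X) (l : Fin d), ∑ m, B l m * lam u m = K (u, y l))
    (Δ : Matrix (Fin d) (Fin d) ℝ)
    (hΔ : Δ = (B.transpose)⁻¹ * Γ⁻¹) :
    ∀ (u : X) (v : Y),
      (∑ m, lam u m * q m v) = ∑ l, ∑ m, Δ l m * K (u, y l) * K (x m, v) := by
  intro u v
  have hk : (fun l => K (u, y l)) = Matrix.vecMul (lam u) B.transpose := by
    rw [Matrix.vecMul_transpose]
    funext l
    exact (hlam u l).symm
  have hx : (fun m => K (x m, v)) = Matrix.mulVec Γ (fun m => q m v) := by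
    funext j
    exact hΓ j v
  have hBd : IsUnit B.transpose.det := by
    rw [Matrix.det_transpose]
    exact (Matrix.isUnit_iff_isUnit_det B).1 hBinv
  have hGd : IsUnit Γ.det := (Matrix.isUnit_iff_isUnit_det Γ).1 hΓinv
  have hR : (∑ l, ∑ m, Δ l m * K (u, y l) * K (x m, v))
      = dotProduct (fun l => K (u, y l)) (Matrix.mulVec Δ (fun m => K (x m, v))) := by
    simp only [dotProduct, Matrix.mulVec, Finset.mul_sum]
    refine Finset.sum_congr rfl fun l _ => Finset.sum_congr rfl fun m _ => ?_
    ring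
  rw [hR, hk, hx, Matrix.mulVec_mulVec, ← Matrix.dotProduct_mulVec, Matrix.mulVec_mulVec, hΔ,
    Matrix.mul_assoc, Matrix.nonsing_inv_mul _ hGd, Matrix.mul_one,
    Matrix.mul_nonsing_inv _ hBd, Matrix.one_mulVec]
  rfl
end

section
/- Exact four-summation far-field formula: assume K : ℝ × ℝ → ℝ is translation invariant, i.e. K(x, y) = K(x − a, y − a) for all x, y, a ∈ ℝ. Assume there are points y_1,…,y_d ∈ J_0, x_1,…,x_d ∈ I_0 and a matrix Δ ∈ ℝ^{d×d} with K(u, v) = Σ_{l,m=1}^d Δ_{l,m} K(u, y_l) K(x_m, v) for all (u, v) ∈ I_0 × J_0, and points ŷ_1,…,ŷ_d ∈ I_0, x̂_1,…,x̂_d ∈ J_0 and a matrix Δ' ∈ ℝ^{d×d} with K(u, v) = Σ_{l',m'=1}^d Δ'_{l',m'} K(u, ŷ_{l'}) K(x̂_{m'}, v) for all (u, v) ∈ J_0 × I_0. Let I = [c_I − l, c_I + l] and J = [c_J − l, c_J + l] be boxes contained in [−L/2, L/2] with |c_I − c_J| ≥ 4l. Then for all x ∈ I and y ∈ J, K(x,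 y) = Σ_{l'=1}^d K(x − c_I, ŷ_{l'}) Σ_{m'=1}^d Δ'_{l',m'} Σ_{l=1}^d K(x̂_{m'}, y_l + c_J − c_I) Σ_{m=1}^d Δ_{l,m} K(x_m, y − c_J). -/
/-- exact four-summation far-field formula for a translation-invariant
kernel, using the two EIM approximations (assumed exact) on `I_0 × J_0` and
`J_0 × I_0`. -/
theorem four_summation_far_field_formula
    (L l : ℝ) (hL : 0 < L) (hl : 0 < l) (hlL : l ≤ L / 4)
    (d : ℕ) (hd : 1 ≤ d)
    (K : ℝ × ℝ → ℝ)
    (hK : ∀ x y a : ℝ, K (x, y) = K (x - a, y - a))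
    (ypt xpt : Fin d → ℝ)
    (hy : ∀ i, ypt i ∈ Set.Icc (-l) l)
    (hx : ∀ i, xpt i ∈ Set.Icc (-L + l) (-(3 * l)) ∪ Set.Icc (3 * l) (L - l))
    (Δ : Matrix (Fin d) (Fin d) ℝ)
    (hΔ : ∀ u ∈ Set.Icc (-L + l) (-(3 * l)) ∪ Set.Icc (3 * l) (L - l),
          ∀ v ∈ Set.Icc (-l) l,
          K (u, v) = ∑ li, ∑ m, Δ li m * K (u, ypt li) * K (xpt m, v))
    (yht xht : Fin d → ℝ)
    (hyh : ∀ i, yht i ∈ Set.Icc (-L + l) (-(3 * l)) ∪ Set.Icc (3 * l) (L - l))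
    (hxh : ∀ i, xht i ∈ Set.Icc (-l) l)
    (Δ' : Matrix (Fin d) (Fin d) ℝ)
    (hΔ' : ∀ u ∈ Set.Icc (-l) l,
           ∀ v ∈ Set.Icc (-L + l) (-(3 * l)) ∪ Set.Icc (3 * l) (L - l),
           K (u, v) = ∑ l', ∑ m', Δ' l' m' * K (u, yht l') * K (xht m', v))
    (cI cJ : ℝ)
    (hI : Set.Icc (cI - l) (cI + l) ⊆ Set.Icc (-(L / 2)) (L / 2))
    (hJ : Set.Icc (cJ - l) (cJ + l) ⊆ Set.Icc (-(L / 2)) (L / 2))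
    (hsep : 4 * l ≤ |cI - cJ|) :
    ∀ x ∈ Set.Icc (cI - l) (cI + l), ∀ y ∈ Set.Icc (cJ - l) (cJ + l),
      K (x, y) =
        ∑ l', K (x - cI, yht l') *
          ∑ m', Δ' l' m' *
            ∑ li, K (xht m', ypt li + cJ - cI) *
              ∑ m, Δ li m * K (xpt m, y - cJ) := by
  intro x hxI y hyJ
  have i1 := hI (Set.left_mem_Icc.2 (by linarith))
  have i2 := hI (Set.right_mem_Icc.2 (by linarith))
  have j1 := hJ (Set.left_mem_Icc.2 (by linarith))
  have j2 := hJ (Set.right_mem_Icc.2 (by linarith))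
  simp only [Set.mem_Icc] at i1 i2 j1 j2 hxI hyJ
  have h1 : x - cJ ∈ Set.Icc (-L + l) (-(3 * l)) ∪ Set.Icc (3 * l) (L - l) := by
    rcases le_abs.1 hsep with h | h
    · right; constructor <;> linarith
    · left; constructor <;> linarith
  have h2 : ∀ i, ypt i + cJ - cI ∈
      Set.Icc (-L + l) (-(3 * l)) ∪ Set.Icc (3 * l) (L - l) := by
    intro i
    have := hy i
    simp only [Set.mem_Icc] at this
    rcases le_abs.1 hsep with h | h
    · left; constructor <;> linarith
    · right; constructor <;> linarith
  have h3 : ∀ i, K (x - cJ, ypt i) = ∑ l', K (x - cI, yht l') *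
      ∑ m', Δ' l' m' * K (xht m', ypt i + cJ - cI) := by
    intro i
    rw [hK (x - cJ) (ypt i) (cI - cJ),
      show x - cJ - (cI - cJ) = x - cI by ring,
      show ypt i - (cI - cJ) = ypt i + cJ - cI by ring,
      hΔ' (x - cI) (by constructor <;> linarith) _ (h2 i)]
    refine Finset.sum_congr rfl fun l' _ => ?_
    rw [Finset.mul_sum]
    exact Finset.sum_congr rfl fun m' _ => by ring
  have h4 : K (x, y) = ∑ li, K (x - cJ, ypt li) * ∑ m, Δ li m * K (xpt m, y - cJ) := by
    rw [hK x y cJ, hΔ _ h1 (y - cJ) (by constructor <;> linarith)]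
    refine Finset.sum_congr rfl fun li _ => ?_
    rw [Finset.mul_sum]
    exact Finset.sum_congr rfl fun m _ => by ring
  rw [h4]
  simp only [h3]
  simp only [Finset.sum_mul]
  rw [Finset.sum_comm]
  refine Finset.sum_congr rfl fun l' _ => ?_
  simp only [mul_assoc]
  rw [← Finset.mul_sum]
  congr 1
  simp only [Finset.sum_mul]
  rw [Finset.sum_comm]
  refine Finset.sum_congr rfl fun m' _ => ?_
  simp only [mul_assoc]
  rw [← Finset.mul_sum]
end

section
/- Exact M2M recursion: assume K : ℝ × ℝ → ℝ is translation invariant, i.e. K(x, y) = K(x − a, y − a) for all x, y, a ∈ ℝ. Let L > 0, 0 < l ≤ L/6, and suppose there are points y_1,…,y_d ∈ [−l, l], x_1,…,x_d ∈ [−L + l, −3l] ∪ [3l, L − l] and a matrix Δ ∈ ℝ^{d×d} such that K(u, v) = Σ_{p,q=1}^d Δ_{p,q} K(u, y_p) K(x_q, v) for all u ∈ [−L + l, −3l] ∪ [3l, L − l] and v ∈ [−l, l]. Let S be a finite set of source points with weights σ : S → ℝ, partitioned into pairwise disjoint subsets S_1, …, S_p, let c, c_1, …, c_p ∈ ℝ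 satisfy |c − c_i| ≤ l and S_i ⊆ [c_i − l, c_i + l] for all i, and let x_m^{coarse} ∈ [−L + 2l, −6l] ∪ [6l, L − 2l]. Then Σ_{ȳ ∈ S} σ(ȳ) K(x_m^{coarse}, ȳ − c) = Σ_{p,q=1}^d Δ_{p,q} Σ_{i=1}^p K(x_m^{coarse} + c − c_i, y_p) W_q^i, where W_q^i = Σ_{ȳ ∈ S_i} σ(ȳ) K(x_q, ȳ − c_i). -/
/-- exact M2M recursion for a translation-invariant kernel, assuming
the EIM formula is exact on the fine-level reference domains. -/
theorem m2m_recursion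
    (L l : ℝ) (hL : 0 < L) (hl : 0 < l) (hlL : l ≤ L / 6)
    (d : ℕ) (hd : 1 ≤ d)
    (K : ℝ × ℝ → ℝ)
    (hK : ∀ x y a : ℝ, K (x, y) = K (x - a, y - a))
    (ypt xpt : Fin d → ℝ)
    (hy : ∀ i, ypt i ∈ Set.Icc (-l) l)
    (hx : ∀ i, xpt i ∈ Set.Icc (-L + l) (-(3 * l)) ∪ Set.Icc (3 * l) (L - l))
    (Δ : Matrix (Fin d) (Fin d) ℝ)
    (hΔ : ∀ u ∈ Set.Icc (-L + l) (-(3 * l)) ∪ Set.Icc (3 * l) (L - l),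
          ∀ v ∈ Set.Icc (-l) l,
          K (u, v) = ∑ p, ∑ q, Δ p q * K (u, ypt p) * K (xpt q, v))
    (n : ℕ) (S : Finset ℝ) (Sp : Fin n → Finset ℝ) (w : ℝ → ℝ)
    (hdisj : ∀ i j : Fin n, i ≠ j → Disjoint (Sp i) (Sp j))
    (hunion : (S : Set ℝ) = ⋃ i, (Sp i : Set ℝ))
    (c : ℝ) (ci : Fin n → ℝ)
    (hci : ∀ i, |c - ci i| ≤ l)
    (hSi : ∀ i, (Sp i : Set ℝ) ⊆ Set.Icc (ci i - l) (ci i + l))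
    (xm : ℝ)
    (hxm : xm ∈ Set.Icc (-L + 2 * l) (-(6 * l)) ∪ Set.Icc (6 * l) (L - 2 * l))
    (W : Fin d → Fin n → ℝ)
    (hW : ∀ (q : Fin d) (i : Fin n), W q i = ∑ yb ∈ Sp i, w yb * K (xpt q, yb - ci i)) :
    ∑ yb ∈ S, w yb * K (xm, yb - c) =
      ∑ p, ∑ q, Δ p q * ∑ i, K (xm + c - ci i, ypt p) * W q i := by
  have hS : S = Finset.univ.biUnion Sp := by
    ext a
    have h : a ∈ (S : Set ℝ) ↔ a ∈ ⋃ i, (Sp i : Set ℝ) := by rw [hunion]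
    simpa using h
  have key : ∀ i, ∀ yb ∈ Sp i, w yb * K (xm, yb - c) =
      ∑ p, ∑ q, Δ p q * (K (xm + c - ci i, ypt p) * (w yb * K (xpt q, yb - ci i))) := by
    intro i yb hyb
    have h1 := hSi i hyb
    have h2 := abs_le.mp (hci i)
    have e : K (xm, yb - c) = K (xm + c - ci i, yb - ci i) := by
      rw [hK xm (yb - c) (ci i - c)]
      congr 2 <;> ring
    rw [e, hΔ (xm + c - ci i) _ (yb - ci i) _, Finset.mul_sum]
    · refine Finset.sum_congr rfl fun p _ => ?_
      rw [Finset.mul_sum]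
      refine Finset.sum_congr rfl fun q _ => ?_
      ring
    · rcases hxm with h | h
      · left
        constructor <;> linarith [h.1, h.2, h2.1, h2.2]
      · right
        constructor <;> linarith [h.1, h.2, h2.1, h2.2]
    · constructor <;> linarith [h1.1, h1.2]
  rw [hS, Finset.sum_biUnion (fun i _ j _ hij => hdisj i j hij)]
  rw [Finset.sum_congr rfl fun i _ => Finset.sum_congr rfl (key i)]
  simp only [hW, Finset.mul_sum]
  rw [Finset.sum_congr rfl fun i _ => Finset.sum_comm, Finset.sum_comm]
  refine Finset.sum_congr rfl fun p _ => ?_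
  rw [Finset.sum_congr rfl fun i _ => Finset.sum_comm, Finset.sum_comm]
end

section
/- Center bounds for children of well-separated boxes: let k ≥ 0, let i, j ∈ {0, …, 2^k − 1} satisfy |c_{k,i} − c_{k,j}| ≥ 4 l_k (well-separatedness at level k), and let j' ∈ {2j, 2j+1} be a child of j. Then 7 l_{k+1} ≤ |c_{k+1,j'} − c_{k,i}| ≤ L − 3 l_{k+1}. -/
/-- Half-length of the boxes at level `k` of the dyadic partition of `[-L/2, L/2]`. -/
noncomputable def boxHalf (L : ℝ) (k : ℕ) : ℝ := L / 2 ^ (k + 1)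

/-- Center of box `j` at level `k` of the dyadic partition of `[-L/2, L/2]`. -/
noncomputable def boxCenter (L : ℝ) (k j : ℕ) : ℝ :=
  -L / 2 + (2 * (j : ℝ) + 1) * boxHalf L k

/-- center bounds for children of well-separated boxes:
if boxes `i` and `j` at level `k` are well-separated and `j'` is a child of `j`,
then `7 l_{k+1} ≤ |c_{k+1,j'} - c_{k,i}| ≤ L - 3 l_{k+1}`. -/
theorem child_of_well_separated_center_bounds
    (L : ℝ) (hL : 0 < L) (k i j j' : ℕ)
    (hi : i ≤ 2 ^ k - 1) (hj : j ≤ 2 ^ k - 1)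
    (hsep : 4 * boxHalf L k ≤ |boxCenter L k i - boxCenter L k j|)
    (hj' : j' = 2 * j ∨ j' = 2 * j + 1) :
    7 * boxHalf L (k + 1) ≤ |boxCenter L (k + 1) j' - boxCenter L k i| ∧
    |boxCenter L (k + 1) j' - boxCenter L k i| ≤ L - 3 * boxHalf L (k + 1) := by
  have h2 : boxHalf L k = 2 * boxHalf L (k + 1) := by
    unfold boxHalf
    field_simp
    ring
  have hLN : L = 4 * 2 ^ k * boxHalf L (k + 1) := by
    unfold boxHalf
    field_simp
    ring
  have hpos : 0 < boxHalf L (k + 1) := by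
    unfold boxHalf
    positivity
  have hp : 1 ≤ 2 ^ k := Nat.one_le_two_pow
  have hi1 : (i : ℝ) + 1 ≤ 2 ^ k := by
    have : i + 1 ≤ 2 ^ k := by omega
    exact_mod_cast this
  have hj1 : (j : ℝ) + 1 ≤ 2 ^ k := by
    have : j + 1 ≤ 2 ^ k := by omega
    exact_mod_cast this
  have hi0 : (0 : ℝ) ≤ i := Nat.cast_nonneg i
  have hj0 : (0 : ℝ) ≤ j := Nat.cast_nonneg j
  unfold boxCenter at hsep ⊢
  rw [h2] at hsep ⊢
  generalize boxHalf L (k + 1) = h at *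
  have e1 : -L / 2 + (2 * (i : ℝ) + 1) * (2 * h) - (-L / 2 + (2 * (j : ℝ) + 1) * (2 * h))
      = (4 * ((i : ℝ) - j)) * h := by ring
  rw [e1, abs_mul, abs_of_pos hpos] at hsep
  have hs : 8 ≤ |4 * ((i : ℝ) - j)| := by
    by_contra hc
    nlinarith
  obtain ⟨e, he, hee⟩ : ∃ e : ℝ, (e = -1 ∨ e = 1) ∧
      -L / 2 + (2 * (j' : ℝ) + 1) * h - (-L / 2 + (2 * (i : ℝ) + 1) * (2 * h))
        = (4 * ((j : ℝ) - i) + e) * h := by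
    rcases hj' with rfl | rfl
    · exact ⟨-1, Or.inl rfl, by push_cast; ring⟩
    · exact ⟨1, Or.inr rfl, by push_cast; ring⟩
  have hr : L - 3 * h = (4 * 2 ^ k - 3) * h := by linarith
  rw [hee, hr, abs_mul, abs_of_pos hpos]
  constructor
  · apply mul_le_mul_of_nonneg_right _ hpos.le
    rw [le_abs] at hs ⊢
    rcases hs with hs | hs
    · right
      rcases he with rfl | rfl <;> linarith
    · left
      rcases he with rfl | rfl <;> linarith
  · apply mul_le_mul_of_nonneg_right _ hpos.le
    rw [abs_le]
    rcases he with rfl | rfl <;> constructor <;> linarith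
end
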